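/- With the vector field F = (P,Q,R) of the previous construction (coefficients satisfying a₈ = 2/3 − a₃, a₁₀ = (3/2)(a₅ − a₇), b₁ = −3a₂ + a₄ + 3b₃, b₂ = 1 − a₃ − c₁₀/3, b₄ = 3 − a₁ − c₁₀, b₆ = (a₅ − a₇)/2, b₇ = 2a₆ + b₅, b₈ = 2a₂ − a₄ − a₉ − b₃, b₉ = −1/3 + a₃ + c₁₀/3, b₁₀ = 3a₆, c₅ = −2/3 + a₁/3 + a₃ + c₁₀/3, c₆ = 2a₄/3 − a₂ + b₃, c₇ = 4/3 − a₁/3 − a₃ − c₁₀/3, c₈ = (a₅ + a₇)/2, c₉ = a₆ + b₅), the plane z = 0 is invariant (the third component R vanishes when z = 0), the divergence satisfies ∇·F(x,y,z) = −3 + (1 + 4a₁)x² + (13 − 4a₁ − 4c₁₀)y² + (24a₆ + 12b₅)yz + (1 + 4c₁₀)z² + x((4a₄ + 12b₃)y + 12a₅z), and if a₁ > 0 then there exists a nonempty open subset of ℝ³ on which ∇·F > 0. -/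

import Mathlib

theorem deriv_cubic (a b c d x : ℝ) :
    deriv (fun t : ℝ => a * t ^ 3 + b * t ^ 2 + c * t + d) x
      = 3 * a * x ^ 2 + 2 * b * x + c := by
  have h := ((((hasDerivAt_pow 3 x).const_mul a).add
    ((hasDerivAt_pow 2 x).const_mul b)).add ((hasDerivAt_id x).const_mul c)).add_const d
  refine Eq.trans h.deriv ?_
  norm_num
  ring

/-- For the cubic vector field `F = (P,Q,R)` with the prescribed
coefficient relations: the plane `z = 0` is invariant, the divergence has the explicit
form `-3 + (1+4a₁)x² + (13-4a₁-4c₁₀)y² + (24a₆+12b₅)yz + (1+4c₁₀)z² + x((4a₄+12b₃)y + 12a₅z)`,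
and if `a₁ > 0` there is a nonempty open set on which `∇·F > 0`. -/
theorem stmt19 (A₂ a₁ a₂ a₃ a₄ a₅ a₆ a₇ a₈ a₉ a₁₀ b₁ b₂ b₃ b₄ b₅ b₆ b₇ b₈ b₉ b₁₀
      c₅ c₆ c₇ c₈ c₉ c₁₀ : ℝ)
    (ha₈ : a₈ = 2 / 3 - a₃) (ha₁₀ : a₁₀ = 3 / 2 * (a₅ - a₇))
    (hb₁ : b₁ = -3 * a₂ + a₄ + 3 * b₃) (hb₂ : b₂ = 1 - a₃ - c₁₀ / 3)
    (hb₄ : b₄ = 3 - a₁ - c₁₀) (hb₆ : b₆ = (a₅ - a₇) / 2) (hb₇ : b₇ = 2 * a₆ + b₅)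
    (hb₈ : b₈ = 2 * a₂ - a₄ - a₉ - b₃) (hb₉ : b₉ = -(1 / 3) + a₃ + c₁₀ / 3)
    (hb₁₀ : b₁₀ = 3 * a₆)
    (hc₅ : c₅ = -(2 / 3) + a₁ / 3 + a₃ + c₁₀ / 3) (hc₆ : c₆ = 2 * a₄ / 3 - a₂ + b₃)
    (hc₇ : c₇ = 4 / 3 - a₁ / 3 - a₃ - c₁₀ / 3) (hc₈ : c₈ = (a₅ + a₇) / 2)
    (hc₉ : c₉ = a₆ + b₅)
    (P Q R : ℝ → ℝ → ℝ → ℝ)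
    (hP : ∀ x y z, P x y z = -x + A₂ * y + a₁ * x ^ 3 + 3 * a₂ * x ^ 2 * y
      + 3 * a₃ * x * y ^ 2 + a₄ * y ^ 3 + 3 * a₅ * x ^ 2 * z + 6 * a₆ * x * y * z
      + 3 * a₇ * y ^ 2 * z + 3 * a₈ * x * z ^ 2 + 3 * a₉ * y * z ^ 2 + a₁₀ * z ^ 3)
    (hQ : ∀ x y z, Q x y z = -A₂ * x - y + b₁ * x ^ 3 + 3 * b₂ * x ^ 2 * y
      + 3 * b₃ * x * y ^ 2 + b₄ * y ^ 3 + 3 * b₅ * x ^ 2 * z + 6 * b₆ * x * y * z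
      + 3 * b₇ * y ^ 2 * z + 3 * b₈ * x * z ^ 2 + 3 * b₉ * y * z ^ 2 + b₁₀ * z ^ 3)
    (hRR : ∀ x y z, R x y z = z * (-1 + 3 * c₅ * x ^ 2 + 6 * c₆ * x * y
      + 3 * c₇ * y ^ 2 + 3 * c₈ * x * z + 3 * c₉ * y * z + c₁₀ * z ^ 2))
    (divF : ℝ → ℝ → ℝ → ℝ)
    (hdivF : ∀ x y z, divF x y z = deriv (fun x' => P x' y z) x
      + deriv (fun y' => Q x y' z) y + deriv (fun z' => R x y z') z) :
    (∀ x y : ℝ, R x y 0 = 0) ∧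
    (∀ x y z : ℝ, divF x y z = -3 + (1 + 4 * a₁) * x ^ 2
      + (13 - 4 * a₁ - 4 * c₁₀) * y ^ 2 + (24 * a₆ + 12 * b₅) * y * z
      + (1 + 4 * c₁₀) * z ^ 2 + x * ((4 * a₄ + 12 * b₃) * y + 12 * a₅ * z)) ∧
    (0 < a₁ → ∃ U : Set (ℝ × ℝ × ℝ), IsOpen U ∧ U.Nonempty ∧
      ∀ p ∈ U, 0 < divF p.1 p.2.1 p.2.2) := by
  have hdiv : ∀ x y z : ℝ, divF x y z = -3 + (1 + 4 * a₁) * x ^ 2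
      + (13 - 4 * a₁ - 4 * c₁₀) * y ^ 2 + (24 * a₆ + 12 * b₅) * y * z
      + (1 + 4 * c₁₀) * z ^ 2 + x * ((4 * a₄ + 12 * b₃) * y + 12 * a₅ * z) := by
    intro x y z
    have hPx : (fun x' => P x' y z) = fun t => a₁ * t ^ 3 + (3 * a₂ * y + 3 * a₅ * z) * t ^ 2
        + (-1 + 3 * a₃ * y ^ 2 + 6 * a₆ * y * z + 3 * a₈ * z ^ 2) * t
        + (A₂ * y + a₄ * y ^ 3 + 3 * a₇ * y ^ 2 * z + 3 * a₉ * y * z ^ 2 + a₁₀ * z ^ 3) := by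
      funext t
      rw [hP]
      ring
    have hQy : (fun y' => Q x y' z) = fun t => b₄ * t ^ 3 + (3 * b₃ * x + 3 * b₇ * z) * t ^ 2
        + (-1 + 3 * b₂ * x ^ 2 + 6 * b₆ * x * z + 3 * b₉ * z ^ 2) * t
        + (-A₂ * x + b₁ * x ^ 3 + 3 * b₅ * x ^ 2 * z + 3 * b₈ * x * z ^ 2 + b₁₀ * z ^ 3) := by
      funext t
      rw [hQ]
      ring
    have hRz : (fun z' => R x y z') = fun t => c₁₀ * t ^ 3 + (3 * c₈ * x + 3 * c₉ * y) * t ^ 2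
        + (-1 + 3 * c₅ * x ^ 2 + 6 * c₆ * x * y + 3 * c₇ * y ^ 2) * t + 0 := by
      funext t
      rw [hRR]
      ring
    rw [hdivF, hPx, hQy, hRz, deriv_cubic, deriv_cubic, deriv_cubic]
    subst_vars
    ring
  refine ⟨fun x y => by simp [hRR], hdiv, fun ha => ?_⟩
  refine ⟨{p | 0 < divF p.1 p.2.1 p.2.2}, ?_, ⟨(2, 0, 0), ?_⟩, fun p hp => hp⟩
  · simp only [hdiv]
    exact isOpen_lt continuous_const (by fun_prop)
  · simp only [Set.mem_ofPred_eq, hdiv]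
    linarith
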